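/- Let a, b ∈ ℝ with 0 ≤ b ≤ a ≤ 1, and write m := (a+b)/2. Then the supremum of d₁ + d₂ over R(m,m) equals (4 + a + b)/3, and consequently sup{d₁+d₂ over R(m,m)} ≥ sup{d₁+d₂ over R(a,b)}, with equality if and only if 2a − b ≤ 1. -/

import Mathlib

/-- The DoF region of the two-user MISO BC with sufficiently good delayed CSIT. -/
def dofRegion (a b : ℝ) : Set (ℝ × ℝ) :=
  {p : ℝ × ℝ | 0 ≤ p.1 ∧ p.1 ≤ 1 ∧ 0 ≤ p.2 ∧ p.2 ≤ 1 ∧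
    2 * p.1 + p.2 ≤ 2 + a ∧ 2 * p.2 + p.1 ≤ 2 + b}

/-- The optimal sum DoF: supremum of `d₁ + d₂` over the DoF region. -/
noncomputable def sumDoF (a b : ℝ) : ℝ :=
  sSup ((fun p : ℝ × ℝ => p.1 + p.2) '' dofRegion a b)

/-- A point of the region whose sum bounds all sums over the region attains the optimal sum DoF. -/
theorem sumDoF_eq_of_mem {a b : ℝ} {p : ℝ × ℝ} (hp : p ∈ dofRegion a b)
    (hmax : ∀ q ∈ dofRegion a b, q.1 + q.2 ≤ p.1 + p.2) : sumDoF a b = p.1 + p.2 := by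
  refine IsGreatest.csSup_eq ⟨⟨p, hp, rfl⟩, ?_⟩
  rintro _ ⟨q, hq, rfl⟩
  exact hmax q hq

/-- When `2 * a - b ≤ 1`, the two weighted-sum constraints are simultaneously tight. -/
theorem sumDoF_of_le {a b : ℝ} (hb : 0 ≤ b) (hba : b ≤ a) (ha : a ≤ 1) (h : 2 * a - b ≤ 1) :
    sumDoF a b = (4 + a + b) / 3 := by
  rw [sumDoF_eq_of_mem (p := ((2 + 2 * a - b) / 3, (2 + 2 * b - a) / 3))]
  · ring
  · refine ⟨?_, ?_, ?_, ?_, ?_, ?_⟩ <;> dsimp only <;> linarith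
  · rintro ⟨x, y⟩ ⟨-, -, -, -, h₁, h₂⟩
    dsimp only at *
    linarith

/-- When `1 ≤ 2 * a - b`, the optimum has the first user at full DoF. -/
theorem sumDoF_of_ge {a b : ℝ} (hb : 0 ≤ b) (hba : b ≤ a) (ha : a ≤ 1) (h : 1 ≤ 2 * a - b) :
    sumDoF a b = (3 + b) / 2 := by
  rw [sumDoF_eq_of_mem (p := (1, (1 + b) / 2))]
  · ring
  · refine ⟨?_, ?_, ?_, ?_, ?_, ?_⟩ <;> dsimp only <;> linarith
  · rintro ⟨x, y⟩ ⟨-, hx, -, -, -, h₂⟩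
    dsimp only at *
    linarith

theorem stmt_19 (a b : ℝ) (hb : 0 ≤ b) (hba : b ≤ a) (ha : a ≤ 1) :
    sumDoF ((a + b) / 2) ((a + b) / 2) = (4 + a + b) / 3 ∧
      sumDoF a b ≤ sumDoF ((a + b) / 2) ((a + b) / 2) ∧
      (sumDoF ((a + b) / 2) ((a + b) / 2) = sumDoF a b ↔ 2 * a - b ≤ 1) := by
  have hm : sumDoF ((a + b) / 2) ((a + b) / 2) = (4 + a + b) / 3 := by
    rw [sumDoF_of_le (by linarith) le_rfl (by linarith) (by linarith)]
    ring
  rw [hm]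
  refine ⟨rfl, ?_⟩
  rcases le_or_gt (2 * a - b) 1 with h | h
  · rw [sumDoF_of_le hb hba ha h]
    exact ⟨le_rfl, fun _ => h, fun _ => rfl⟩
  · rw [sumDoF_of_ge hb hba ha h.le]
    exact ⟨by linarith, fun _ => by linarith, fun _ => by linarith⟩
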